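/- For every sufficiently small δ > 0 there exist constants c, C > 0 (depending only on δ) such that for all real T ≥ 2, the sum over all (a₂,a₃,a₄,a₅) ∈ ℤ⁴ with |aᵢ| ≤ T^i for 2 ≤ i ≤ 5 and f nondegenerate, of the number of pairs (x,y) ∈ ℚ² with y² = f(x), |x| < δ^{−1/δ}·H(f), and H(x) < H(f)^{8 − δ}, is at most C·T^{14 − c} (in particular each of these sets of pairs is finite). -/

import Mathlib

/-- The naive height `H(f) = max_{2 ≤ i ≤ 5} |aᵢ|^(1/i)` of
`f(X) = X⁵ + a₂X³ + a₃X² + a₄X + a₅`. -/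
noncomputable def Hf (a₂ a₃ a₄ a₅ : ℤ) : ℝ :=
  max (max ((|a₂| : ℝ) ^ ((1 : ℝ)/2)) ((|a₃| : ℝ) ^ ((1 : ℝ)/3)))
      (max ((|a₄| : ℝ) ^ ((1 : ℝ)/4)) ((|a₅| : ℝ) ^ ((1 : ℝ)/5)))

/-- `f` is nondegenerate: it has five distinct complex roots. -/
def Nondeg (a₂ a₃ a₄ a₅ : ℤ) : Prop :=
  ∃ r : Fin 5 → ℂ, Function.Injective r ∧
    ∀ z : ℂ, z ^ 5 + (a₂ : ℂ) * z ^ 3 + (a₃ : ℂ) * z ^ 2 + (a₄ : ℂ) * z + (a₅ : ℂ) =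
      ∏ i, (z - r i)

/-- The multiplicative height `H(x) = max(|p|, q)` of a rational `x = p/q` in lowest terms. -/
noncomputable def Hq (x : ℚ) : ℝ := max (|x.num| : ℝ) (x.den : ℝ)

/-- Tuples `(a₂,a₃,a₄,a₅,x,y)` where `f` is nondegenerate of height at most `T`, `(x,y)` is an
affine rational point of `y² = f(x)` which is small (`H(x) < H(f)^(8 - δ)`) with small
`x`-coordinate (`|x| < δ^(-1/δ)·H(f)`): the union over the family of the sets `I_f^↓`. -/
noncomputable def SmallDownSet (δ T : ℝ) : Set (ℤ × ℤ × ℤ × ℤ × ℚ × ℚ) :=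
  fun p =>
    (|p.1| : ℝ) ≤ T ^ 2 ∧ (|p.2.1| : ℝ) ≤ T ^ 3 ∧ (|p.2.2.1| : ℝ) ≤ T ^ 4 ∧
    (|p.2.2.2.1| : ℝ) ≤ T ^ 5 ∧ Nondeg p.1 p.2.1 p.2.2.1 p.2.2.2.1 ∧
    p.2.2.2.2.2 ^ 2 = p.2.2.2.2.1 ^ 5 + (p.1 : ℚ) * p.2.2.2.2.1 ^ 3 +
      (p.2.1 : ℚ) * p.2.2.2.2.1 ^ 2 + (p.2.2.1 : ℚ) * p.2.2.2.2.1 + (p.2.2.2.1 : ℚ) ∧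
    |(p.2.2.2.2.1 : ℝ)| < δ ^ (-(1/δ)) * Hf p.1 p.2.1 p.2.2.1 p.2.2.2.1 ∧
    Hq p.2.2.2.2.1 < Hf p.1 p.2.1 p.2.2.1 p.2.2.2.1 ^ ((8 : ℝ) - δ)

theorem card_le_sum_of_card_fiber_le {α β : Type*} [DecidableEq β] (s : Finset α) (t : Finset β)
    (f : α → β) (hf : ∀ a ∈ s, f a ∈ t) (B : β → ℝ)
    (hB : ∀ b ∈ t, ((s.filter (fun a => f a = b)).card : ℝ) ≤ B b) :
    (s.card : ℝ) ≤ ∑ b ∈ t, B b := by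
  rw [Finset.card_eq_sum_card_fiberwise (f := f) (t := t) (fun a ha => hf a ha)]
  push_cast
  exact Finset.sum_le_sum hB

theorem card_le_mul_of_card_fiber_le {α β : Type*} [DecidableEq β] (s : Finset α) (f : α → β)
    {B N : ℝ} (hB0 : 0 ≤ B) (hN : ((s.image f).card : ℝ) ≤ N)
    (hB : ∀ b ∈ s.image f, ((s.filter (fun a => f a = b)).card : ℝ) ≤ B) :
    (s.card : ℝ) ≤ N * B := by
  have h := card_le_sum_of_card_fiber_le s (s.image f) f
    (fun a ha => Finset.mem_image_of_mem f ha) (fun _ => B) hB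
  rw [Finset.sum_const, nsmul_eq_mul] at h
  exact h.trans (mul_le_mul_of_nonneg_right hN hB0)

/-- A finite set injecting into a residue class modulo `m` inside an interval of length `L` has
at most `L / m + 1` elements. -/
theorem card_le_of_dvd_sub {α : Type*} (X : Finset α) (g : α → ℤ) (hg : Set.InjOn g X)
    {m : ℤ} (hm : 0 < m) {L : ℝ} (hL : 0 ≤ L)
    (hdvd : ∀ x ∈ X, ∀ y ∈ X, m ∣ g x - g y)
    (hlen : ∀ x ∈ X, ∀ y ∈ X, ((g x - g y : ℤ) : ℝ) ≤ L) :
    (X.card : ℝ) ≤ L / m + 1 := by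
  have hmR : (0 : ℝ) < m := by exact_mod_cast hm
  rcases X.eq_empty_or_nonempty with rfl | hne
  · simp only [Finset.card_empty, Nat.cast_zero]; positivity
  obtain ⟨x₀, hx₀, hmin⟩ := X.exists_min_image g hne
  have hq : 0 ≤ L / m := by positivity
  have hcard : X.card ≤ (Finset.Icc (0 : ℤ) ⌊L / m⌋).card := by
    refine Finset.card_le_card_of_injOn (fun x => (g x - g x₀) / m) ?_ ?_
    · intro x hx
      obtain ⟨c, hc⟩ := hdvd x hx x₀ hx₀
      have h1 := hmin x hx
      have h2 := hlen x hx x₀ hx₀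
      simp only [Finset.coe_Icc, Set.mem_Icc]
      refine ⟨Int.ediv_nonneg (by linarith) hm.le, ?_⟩
      rw [hc, Int.mul_ediv_cancel_left _ hm.ne', Int.le_floor, le_div_iff₀ hmR]
      rw [hc] at h2
      push_cast at h2
      linarith
    · intro x hx y hy hxy
      obtain ⟨c, hc⟩ := hdvd x hx x₀ hx₀
      obtain ⟨c', hc'⟩ := hdvd y hy x₀ hx₀
      simp only [hc, hc', Int.mul_ediv_cancel_left _ hm.ne'] at hxy
      exact hg hx hy (by rw [hxy] at hc; linarith)
  rw [Int.card_Icc] at hcard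
  have h0 : 0 ≤ ⌊L / m⌋ := Int.floor_nonneg.2 hq
  have h3 : (X.card : ℤ) ≤ ⌊L / m⌋ + 1 := by omega
  have h4 : (X.card : ℝ) ≤ (⌊L / m⌋ : ℝ) + 1 := by exact_mod_cast h3
  linarith [Int.floor_le (L / m)]

theorem abs_sub_le_two_mul {x y B : ℝ} (hx : |x| ≤ B) (hy : |y| ≤ B) : |x - y| ≤ 2 * B := by
  linarith [abs_sub x y]

/-- For `b ≠ 0`, the pairs `(u, k)` with `0 ≤ u < n`, `|k| ≤ K` and `2k ≡ 2bu` modulo `n`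
number `O(K + |b|)`, uniformly in `n`. -/
theorem card_linear_congruence_of_ne_zero (X : Finset (ℤ × ℤ)) {n b : ℤ} (hn : 0 < n)
    (hb : b ≠ 0) {K : ℝ} (hK : 0 ≤ K)
    (hX : ∀ p ∈ X, 0 ≤ p.1 ∧ p.1 < n ∧ |(p.2 : ℝ)| ≤ K ∧ n ∣ 2 * (p.2 - b * p.1)) :
    (X.card : ℝ) ≤ 8 * K + 4 * |(b : ℝ)| := by
  obtain ⟨g, hg⟩ : ∃ g : ℤ, g = (Int.gcd (2 * b) n : ℤ) := ⟨_, rfl⟩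
  have hgb : g ∣ 2 * b := hg ▸ Int.gcd_dvd_left ..
  have hgn : g ∣ n := hg ▸ Int.gcd_dvd_right ..
  have hg0 : 0 < g := by
    rw [hg]; exact_mod_cast Int.gcd_pos_of_ne_zero_right _ hn.ne'
  have hgR : (1 : ℝ) ≤ g := by exact_mod_cast hg0
  have hgle : (g : ℝ) ≤ 2 * |(b : ℝ)| := by
    have h1 : g ≤ |2 * b| := Int.le_of_dvd (by positivity) ((dvd_abs _ _).2 hgb)
    have h2 : (g : ℝ) ≤ ((|2 * b| : ℤ) : ℝ) := by exact_mod_cast h1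
    rw [Int.cast_abs] at h2
    push_cast at h2
    rwa [abs_mul, abs_two] at h2
  obtain ⟨n', hn'⟩ := hgn
  have hn'0 : 0 < n' := by
    by_contra! h
    nlinarith
  obtain ⟨b', hb'⟩ := hgb
  have hcop : IsCoprime n' b' := by
    have h1 := Int.isCoprime_iff_gcd_eq_one.2
      (Int.gcd_ediv_gcd_ediv_gcd (i := 2 * b) (j := n) (by
        exact Int.gcd_pos_of_ne_zero_right _ hn.ne'))
    rw [← hg, hb', hn', Int.mul_ediv_cancel_left _ hg0.ne', Int.mul_ediv_cancel_left _ hg0.ne'] at h1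
    exact h1.symm
  have hfib : ∀ k ∈ X.image Prod.snd,
      ((X.filter (fun p => p.2 = k)).card : ℝ) ≤ g + 1 := by
    intro k _
    have h := card_le_of_dvd_sub (X.filter (fun p => p.2 = k)) Prod.fst ?_ hn'0
      (L := (n : ℝ)) (by exact_mod_cast hn.le) ?_ ?_
    · have : (n : ℝ) / n' = g := by
        rw [hn']; push_cast
        have : (n' : ℝ) ≠ 0 := by exact_mod_cast hn'0.ne'
        field_simp
      rwa [this] at h
    · intro p hp q hq h
      simp only [Finset.coe_filter, Set.mem_ofPred_eq] at hp hq
      exact Prod.ext h (hp.2.trans hq.2.symm)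
    · intro p hp q hq
      simp only [Finset.mem_filter] at hp hq
      have h1 := (hX p hp.1).2.2.2
      have h2 := (hX q hq.1).2.2.2
      have h3 : n ∣ 2 * b * (p.1 - q.1) := by
        have := dvd_sub h2 h1
        rw [hp.2, hq.2] at this
        rwa [show 2 * (k - b * q.1) - 2 * (k - b * p.1) = 2 * b * (p.1 - q.1) by ring] at this
      rw [hn', hb', mul_assoc] at h3
      exact hcop.dvd_of_dvd_mul_left (Int.dvd_of_mul_dvd_mul_left hg0.ne' h3)
    · intro p hp q hq
      simp only [Finset.mem_filter] at hp hq
      have h1 := hX p hp.1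
      have h2 := hX q hq.1
      exact_mod_cast (by linarith : p.1 - q.1 ≤ n)
  have himg : ((X.image Prod.snd).card : ℝ) ≤ 4 * K / g + 1 := by
    refine card_le_of_dvd_sub _ (fun k => 2 * k) (fun x _ y _ h => by simpa using h) hg0
      (by positivity) ?_ ?_
    · have key : ∀ k ∈ X.image Prod.snd, g ∣ 2 * k := by
        intro k hk
        obtain ⟨p, hp, rfl⟩ := Finset.mem_image.1 hk
        have h1 : g ∣ 2 * (p.2 - b * p.1) := (Dvd.intro _ hn'.symm).trans (hX p hp).2.2.2
        have h2 : g ∣ 2 * b * p.1 := Dvd.dvd.mul_right (Dvd.intro _ hb'.symm) _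
        have := dvd_add h1 h2
        rwa [show 2 * (p.2 - b * p.1) + 2 * b * p.1 = 2 * p.2 by ring] at this
      exact fun x hx y hy => dvd_sub (key x hx) (key y hy)
    · have key : ∀ k ∈ X.image Prod.snd, |(k : ℝ)| ≤ K := by
        intro k hk
        obtain ⟨p, hp, rfl⟩ := Finset.mem_image.1 hk
        exact (hX p hp).2.2.1
      intro x hx y hy
      have h1 := abs_le.1 (key x hx)
      have h2 := abs_le.1 (key y hy)
      push_cast
      linarith
  have h := card_le_mul_of_card_fiber_le X Prod.snd (by linarith) himg hfib
  refine h.trans ?_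
  have h1 : (4 * K / g + 1) * ((g : ℝ) + 1) = 4 * K + g + 4 * K / g + 1 := by
    field_simp
    ring
  have h2 : 4 * K / g ≤ 4 * K := div_le_self (by positivity) hgR
  linarith

/-- The triples `(u, k, b)` with `0 ≤ u < n`, `|k| ≤ K`, `|b| ≤ B` and `2k ≡ 2bu` modulo `n`. -/
noncomputable def linearCongruenceSet (n : ℤ) (K B : ℝ) : Finset (ℤ × ℤ × ℤ) :=
  (Finset.Ico 0 n ×ˢ Finset.Icc (-⌊K⌋) ⌊K⌋ ×ˢ Finset.Icc (-⌊B⌋) ⌊B⌋).filter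
    (fun p => n ∣ 2 * (p.2.1 - p.2.2 * p.1))

theorem abs_le_iff_mem_Icc_floor {K : ℝ} {k : ℤ} :
    |(k : ℝ)| ≤ K ↔ k ∈ Finset.Icc (-⌊K⌋) ⌊K⌋ := by
  rw [← Int.cast_abs, ← Int.le_floor, Finset.mem_Icc, abs_le]

theorem mem_linearCongruenceSet {n : ℤ} {K B : ℝ} {p : ℤ × ℤ × ℤ} :
    p ∈ linearCongruenceSet n K B ↔ (0 ≤ p.1 ∧ p.1 < n) ∧ |(p.2.1 : ℝ)| ≤ K ∧
      |(p.2.2 : ℝ)| ≤ B ∧ n ∣ 2 * (p.2.1 - p.2.2 * p.1) := by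
  simp only [linearCongruenceSet, Finset.mem_filter, Finset.mem_product, Finset.mem_Ico,
    abs_le_iff_mem_Icc_floor, and_assoc]

theorem card_Icc_neg_floor {B : ℝ} (hB : 0 ≤ B) :
    ((Finset.Icc (-⌊B⌋) ⌊B⌋).card : ℝ) ≤ 2 * B + 1 := by
  have h0 : 0 ≤ ⌊B⌋ := Int.floor_nonneg.2 hB
  rw [Int.card_Icc]
  have h1 : (((⌊B⌋ + 1 - -⌊B⌋).toNat : ℤ) : ℝ) = ((2 * ⌊B⌋ + 1 : ℤ) : ℝ) := by
    congr 1
    omega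
  rw [← Int.cast_natCast, h1]
  push_cast
  linarith [Int.floor_le B]

theorem card_linearCongruenceSet {n : ℤ} (hn : 0 < n) {K B : ℝ} (hK : 0 ≤ K) (hB : 0 ≤ B) :
    ((linearCongruenceSet n K B).card : ℝ) ≤ (4 * K + n) + (2 * B + 1) * (8 * K + 4 * B) := by
  have hnR : (0 : ℝ) < n := by exact_mod_cast hn
  have h := card_le_sum_of_card_fiber_le (linearCongruenceSet n K B)
    (Finset.Icc (-⌊B⌋) ⌊B⌋) (fun p => p.2.2)
    (fun p hp => abs_le_iff_mem_Icc_floor.1 (mem_linearCongruenceSet.1 hp).2.2.1)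
    (fun b => (if b = 0 then 4 * K + n else 0) + (8 * K + 4 * B)) ?_
  · refine h.trans ?_
    rw [Finset.sum_add_distrib, Finset.sum_const, nsmul_eq_mul, Finset.sum_ite_eq']
    refine add_le_add ?_ (mul_le_mul_of_nonneg_right (card_Icc_neg_floor hB) (by positivity))
    split_ifs
    · exact le_rfl
    · positivity
  intro b hb
  set X := (linearCongruenceSet n K B).filter (fun p => p.2.2 = b) with hX
  have hmem : ∀ p ∈ X, ((0 ≤ p.1 ∧ p.1 < n) ∧ |(p.2.1 : ℝ)| ≤ K ∧
      |(p.2.2 : ℝ)| ≤ B ∧ n ∣ 2 * (p.2.1 - p.2.2 * p.1)) ∧ p.2.2 = b := by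
    intro p hp
    rw [hX, Finset.mem_filter, mem_linearCongruenceSet] at hp
    exact hp
  split_ifs with hb0
  · subst hb0
    have h2 := card_le_sum_of_card_fiber_le X (Finset.Ico 0 n) (fun p => p.1)
      (fun p hp => Finset.mem_Ico.2 (hmem p hp).1.1) (fun _ => 4 * K / n + 1) ?_
    · rw [Finset.sum_const, nsmul_eq_mul, Int.card_Ico, sub_zero] at h2
      have h3 : ((n.toNat : ℕ) : ℝ) = n := by
        rw [← Int.cast_natCast, Int.toNat_of_nonneg hn.le]
      rw [h3] at h2
      have h4 : (n : ℝ) * (4 * K / n + 1) = 4 * K + n := by field_simp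
      rw [h4] at h2
      linarith
    · intro u _
      refine card_le_of_dvd_sub _ (fun p => 2 * p.2.1) ?_ hn (by positivity) ?_ ?_
      · intro p hp q hq hpq
        simp only [Finset.coe_filter, Set.mem_ofPred_eq] at hp hq
        have h5 := (hmem p hp.1).2
        have h6 := (hmem q hq.1).2
        refine Prod.ext (hp.2.trans hq.2.symm) (Prod.ext ?_ (h5.trans h6.symm))
        simpa using hpq
      · intro p hp q hq
        have h5 := hmem p (Finset.mem_filter.1 hp).1
        have h6 := hmem q (Finset.mem_filter.1 hq).1
        have h7 := h5.1.2.2.2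
        have h8 := h6.1.2.2.2
        rw [h5.2, zero_mul, sub_zero] at h7
        rw [h6.2, zero_mul, sub_zero] at h8
        exact dvd_sub h7 h8
      · intro p hp q hq
        have h5 := abs_le.1 (hmem p (Finset.mem_filter.1 hp).1).1.2.1
        have h6 := abs_le.1 (hmem q (Finset.mem_filter.1 hq).1).1.2.1
        push_cast
        linarith
  · rw [zero_add]
    have hcard : X.card = (X.image (fun p => (p.1, p.2.1))).card := by
      refine (Finset.card_image_of_injOn ?_).symm
      intro p hp q hq hpq
      simp only [Prod.mk.injEq] at hpq
      exact Prod.ext hpq.1 (Prod.ext hpq.2 ((hmem p hp).2.trans (hmem q hq).2.symm))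
    rw [hcard]
    have hbB : |(b : ℝ)| ≤ B := abs_le_iff_mem_Icc_floor.2 hb
    refine (card_linear_congruence_of_ne_zero _ hn hb0 hK ?_).trans
      (by linarith : 8 * K + 4 * |(b : ℝ)| ≤ _)
    intro r hr
    obtain ⟨p, hp, rfl⟩ := Finset.mem_image.1 hr
    obtain ⟨h5, h6⟩ := hmem p hp
    rw [h6] at h5
    exact ⟨h5.1.1, h5.1.2, h5.2.1, h5.2.2.2⟩

/-- If `s` is a unit modulo `n` and `e² ≡ s⁵`, then `u = e s⁻²` satisfies `u² ≡ s`, `u⁵ ≡ e`. -/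
theorem exists_sqrt_residue {n s e : ℤ} (hn : 0 < n) (hs : IsCoprime s n) (he : n ∣ e ^ 2 - s ^ 5) :
    ∃ u : ℤ, (0 ≤ u ∧ u < n) ∧ n ∣ u ^ 2 - s ∧ n ∣ u ^ 5 - e := by
  obtain ⟨v, w, hvw⟩ := hs
  have hv : s * v ≡ 1 [ZMOD n] := by
    refine Int.ModEq.symm (Int.modEq_iff_dvd.2 ⟨-w, ?_⟩)
    linear_combination hvw
  have he' : e ^ 2 ≡ s ^ 5 [ZMOD n] := (Int.modEq_iff_dvd.2 he).symm
  have hu : e * v ^ 2 % n ≡ e * v ^ 2 [ZMOD n] := Int.mod_modEq _ _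
  have h2 : (e * v ^ 2) ^ 2 ≡ s [ZMOD n] := by
    calc (e * v ^ 2) ^ 2 = e ^ 2 * v ^ 4 := by ring
      _ ≡ s ^ 5 * v ^ 4 [ZMOD n] := he'.mul_right _
      _ = s * (s * v) ^ 4 := by ring
      _ ≡ s * 1 ^ 4 [ZMOD n] := (hv.pow 4).mul_left _
      _ = s := by ring
  have h5 : (e * v ^ 2) ^ 5 ≡ e [ZMOD n] := by
    calc (e * v ^ 2) ^ 5 = ((e * v ^ 2) ^ 2) ^ 2 * v ^ 2 * e := by ring
      _ ≡ s ^ 2 * v ^ 2 * e [ZMOD n] := ((h2.pow 2).mul_right _).mul_right _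
      _ = (s * v) ^ 2 * e := by ring
      _ ≡ 1 ^ 2 * e [ZMOD n] := (hv.pow 2).mul_right _
      _ = e := by ring
  exact ⟨e * v ^ 2 % n, ⟨Int.emod_nonneg _ hn.ne', Int.emod_lt_of_pos _ hn⟩,
    ((hu.pow 2).trans h2).symm.dvd, ((hu.pow 5).trans h5).symm.dvd⟩

/-- Two solutions of `e² ≡ s⁵ + a s³ d⁴` modulo `d⁶` with the same `s` and the same square root
`u` of `s` differ by a solution of a homogeneous linear congruence modulo `d²`. -/
theorem exists_linear_congruence_of_sub {d s u e e' a a' : ℤ} (hd : d ≠ 0)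
    (hs : IsCoprime s (d ^ 2)) (hu : d ^ 2 ∣ u ^ 2 - s)
    (he : d ^ 2 ∣ u ^ 5 - e) (he' : d ^ 2 ∣ u ^ 5 - e')
    (ha : d ^ 6 ∣ e ^ 2 - s ^ 5 - a * s ^ 3 * d ^ 4)
    (ha' : d ^ 6 ∣ e' ^ 2 - s ^ 5 - a' * s ^ 3 * d ^ 4) :
    ∃ k : ℤ, 2 * (e - e') = d ^ 4 * k ∧ d ^ 2 ∣ 2 * (k - (a - a') * u) := by
  have hcop : IsCoprime (d ^ 2) (u ^ 5) := by
    obtain ⟨w, hw⟩ := hu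
    obtain ⟨x, y, hxy⟩ := hs
    refine IsCoprime.pow_right (IsCoprime.symm ⟨x * u, y - x * w, ?_⟩)
    linear_combination hxy + x * hw
  obtain ⟨p, hp⟩ := he
  obtain ⟨p', hp'⟩ := he'
  obtain ⟨w, hw⟩ := hu
  obtain ⟨m, hm⟩ := ha
  obtain ⟨m', hm'⟩ := ha'
  have hd2 : d ^ 2 ≠ 0 := pow_ne_zero _ hd
  have hd4 : d ^ 4 ≠ 0 := pow_ne_zero _ hd
  have h1 : d ^ 2 ∣ u ^ 5 * (2 * (p' - p)) := by
    have : d ^ 2 * ((p' - p) * (e + e'))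
        = d ^ 2 * (d ^ 2 * (d ^ 2 * (m - m') + (a - a') * s ^ 3)) := by
      linear_combination hm - hm' - (e + e') * (hp' - hp)
    have h := mul_left_cancel₀ hd2 this
    refine ⟨(d ^ 2 * (m - m') + (a - a') * s ^ 3) + (p' - p) * (p + p'), ?_⟩
    linear_combination h + (p' - p) * (hp + hp')
  obtain ⟨k, hk⟩ := hcop.dvd_of_dvd_mul_left h1
  have hek : 2 * (e - e') = d ^ 4 * k := by
    linear_combination d ^ 2 * hk + 2 * (hp' - hp)
  refine ⟨k, hek, hcop.dvd_of_dvd_mul_left ?_⟩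
  have h2 : d ^ 4 * (k * (e + e')) = d ^ 4 * (2 * (d ^ 2 * (m - m') + (a - a') * s ^ 3)) := by
    linear_combination 2 * (hm - hm') - (e + e') * hek
  have h3 := mul_left_cancel₀ hd4 h2
  refine ⟨2 * (m - m') + k * (p + p')
    - 2 * (a - a') * w * (s ^ 2 + s * u ^ 2 + u ^ 4), ?_⟩
  linear_combination h3 + k * (hp + hp') -
    2 * (a - a') * (s ^ 2 + s * u ^ 2 + u ^ 4) * hw

theorem card_square_congruence (Q : Finset (ℤ × ℤ × ℤ)) {d : ℤ} (hd : 0 < d) {S E A : ℝ}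
    (hS : 0 ≤ S) (hE : 0 ≤ E) (hA : 0 ≤ A)
    (hQ : ∀ q ∈ Q, IsCoprime q.1 (d ^ 2) ∧ |(q.1 : ℝ)| ≤ S ∧ |(q.2.1 : ℝ)| ≤ E ∧
      |(q.2.2 : ℝ)| ≤ A ∧ d ^ 6 ∣ q.2.1 ^ 2 - q.1 ^ 5 - q.2.2 * q.1 ^ 3 * d ^ 4) :
    (Q.card : ℝ) ≤ (2 * S / (d : ℝ) ^ 2 + 1) *
      ((4 * (4 * E / (d : ℝ) ^ 4) + (d : ℝ) ^ 2) +
        (2 * (2 * A) + 1) * (8 * (4 * E / (d : ℝ) ^ 4) + 4 * (2 * A))) := by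
  have hdR : (0 : ℝ) < d := by exact_mod_cast hd
  have hn : 0 < d ^ 2 := by positivity
  have hex : ∀ q : ℤ × ℤ × ℤ, ∃ u : ℤ, q ∈ Q → (0 ≤ u ∧ u < d ^ 2) ∧
      d ^ 2 ∣ u ^ 2 - q.1 ∧ d ^ 2 ∣ u ^ 5 - q.2.1 := by
    intro q
    by_cases hq : q ∈ Q
    · have h := hQ q hq
      have hdvd : d ^ 2 ∣ q.2.1 ^ 2 - q.1 ^ 5 := by
        have h1 := (pow_dvd_pow d (by norm_num : 2 ≤ 6)).trans h.2.2.2.2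
        have h2 : d ^ 2 ∣ q.2.2 * q.1 ^ 3 * d ^ 4 :=
          (pow_dvd_pow d (by norm_num : 2 ≤ 4)).trans (Dvd.intro_left _ rfl)
        have := dvd_add h1 h2
        rwa [sub_add_cancel] at this
      obtain ⟨u, hu⟩ := exists_sqrt_residue hn h.1 hdvd
      exact ⟨u, fun _ => hu⟩
    · exact ⟨0, fun h => absurd h hq⟩
  choose u hu using hex
  set K : ℝ := 4 * E / (d : ℝ) ^ 4 with hK
  set H := linearCongruenceSet (d ^ 2) K (2 * A) with hH
  set N : ℝ := 2 * S / (d : ℝ) ^ 2 + 1 with hN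
  have hK0 : 0 ≤ K := by positivity
  have hN0 : 0 ≤ N := by positivity
  have hHcard := card_linearCongruenceSet hn hK0 (by positivity : 0 ≤ 2 * A)
  push_cast at hHcard
  refine le_trans ?_ (mul_le_mul_of_nonneg_left hHcard hN0)
  rw [← hH, Finset.card_eq_sum_card_fiberwise (s := H) (f := Prod.fst) (t := Finset.Ico 0 (d ^ 2))
    (fun p hp => by simpa using (mem_linearCongruenceSet.1 hp).1)]
  push_cast
  rw [Finset.mul_sum]
  refine card_le_sum_of_card_fiber_le Q (Finset.Ico 0 (d ^ 2)) u
    (fun q hq => Finset.mem_Ico.2 (hu q hq).1) _ ?_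
  intro v _
  set X := Q.filter (fun q => u q = v) with hX
  have hXmem : ∀ q ∈ X, q ∈ Q ∧ ((0 ≤ v ∧ v < d ^ 2) ∧
      d ^ 2 ∣ v ^ 2 - q.1 ∧ d ^ 2 ∣ v ^ 5 - q.2.1) := by
    intro q hq
    obtain ⟨h1, h2⟩ := Finset.mem_filter.1 hq
    exact ⟨h1, h2 ▸ hu q h1⟩
  refine card_le_mul_of_card_fiber_le X Prod.fst (by positivity) ?_ ?_
  · have h := card_le_of_dvd_sub (X.image Prod.fst) id (fun _ _ _ _ h => h) hn
      (L := 2 * S) (by positivity) ?_ ?_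
    · push_cast at h
      exact h
    · have key : ∀ s ∈ X.image Prod.fst, d ^ 2 ∣ v ^ 2 - s := by
        intro s hs
        obtain ⟨q, hq, rfl⟩ := Finset.mem_image.1 hs
        exact (hXmem q hq).2.2.1
      intro s hs s' hs'
      have := dvd_sub (key s' hs') (key s hs)
      rwa [sub_sub_sub_cancel_left] at this
    · have key : ∀ s ∈ X.image Prod.fst, |(s : ℝ)| ≤ S := by
        intro s hs
        obtain ⟨q, hq, rfl⟩ := Finset.mem_image.1 hs
        exact (hQ q (hXmem q hq).1).2.1
      intro s hs s' hs'
      have := (abs_le.1 (abs_sub_le_two_mul (key s hs) (key s' hs'))).2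
      simpa using this
  · intro s _
    set Y := X.filter (fun q => q.1 = s) with hY
    rcases Y.eq_empty_or_nonempty with h0 | ⟨q₀, hq₀⟩
    · rw [h0]; simp
    have hYmem : ∀ q ∈ Y, q ∈ X ∧ q.1 = s := fun q hq => Finset.mem_filter.1 hq
    have hex : ∀ q : ℤ × ℤ × ℤ, ∃ k : ℤ, q ∈ Y → 2 * (q.2.1 - q₀.2.1) = d ^ 4 * k ∧
        d ^ 2 ∣ 2 * (k - (q.2.2 - q₀.2.2) * v) := by
      intro q
      by_cases hq : q ∈ Y
      · obtain ⟨h1, h2⟩ := hYmem q hq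
        obtain ⟨h1', h2'⟩ := hYmem q₀ hq₀
        have h3 := hXmem q h1
        have h3' := hXmem q₀ h1'
        have h4 := hQ q h3.1
        have h4' := hQ q₀ h3'.1
        rw [h2] at h4 h3
        rw [h2'] at h4' h3'
        obtain ⟨k, hk⟩ := exists_linear_congruence_of_sub hd.ne' h4.1 h3.2.2.1 h3.2.2.2
          h3'.2.2.2 h4.2.2.2.2 h4'.2.2.2.2
        exact ⟨k, fun _ => hk⟩
      · exact ⟨0, fun h => absurd h hq⟩
    choose k hk using hex
    have hle : Y.card ≤ (H.filter (fun p => p.1 = v)).card := by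
      refine Finset.card_le_card_of_injOn (fun q => (v, k q, q.2.2 - q₀.2.2)) ?_ ?_
      · intro q hq
        have h1 := hXmem q (hYmem q hq).1
        have h1' := hXmem q₀ (hYmem q₀ hq₀).1
        have h2 := hQ q h1.1
        have h2' := hQ q₀ h1'.1
        have h3 := hk q hq
        simp only [Finset.coe_filter, Set.mem_ofPred_eq, and_true]
        refine mem_linearCongruenceSet.2 ⟨h1.2.1, ?_, ?_, h3.2⟩
        · have h4 := abs_sub_le_two_mul h2.2.2.1 h2'.2.2.1
          have h5 : 2 * ((q.2.1 : ℝ) - q₀.2.1) = (d : ℝ) ^ 4 * k q := by exact_mod_cast h3.1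
          rw [hK, le_div_iff₀ (by positivity)]
          have h6 : |(k q : ℝ)| * (d : ℝ) ^ 4 = 2 * |(q.2.1 : ℝ) - q₀.2.1| := by
            rw [← abs_two, ← abs_mul, h5, abs_mul, abs_of_pos (by positivity : (0 : ℝ) < (d : ℝ) ^ 4),
              mul_comm]
          simp only
          linarith
        · have := abs_sub_le_two_mul h2.2.2.2.1 h2'.2.2.2.1
          simpa using this
      · intro q hq q' hq' h
        simp only [Prod.mk.injEq, true_and] at h
        have h1 := (hk q hq).1
        have h2 := (hk q' hq').1
        rw [h.1] at h1
        refine Prod.ext ((hYmem q hq).2.trans (hYmem q' hq').2.symm)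
          (Prod.ext (by linarith) (by linarith [h.2]))
    exact_mod_cast hle

theorem card_points_of_denominator (P : Finset (ℤ × ℤ × ℤ × ℤ × ℤ × ℤ)) {d : ℤ} (hd : 0 < d)
    {S E A₂ A₃ A₄ : ℝ} (hS : 0 ≤ S) (hE : 0 ≤ E) (hA₂ : 0 ≤ A₂) (hA₃ : 0 ≤ A₃) (hA₄ : 0 ≤ A₄)
    (hP : ∀ p ∈ P, match p with
      | (a₂, a₃, a₄, a₅, s, e) => |(a₂ : ℝ)| ≤ A₂ ∧ |(a₃ : ℝ)| ≤ A₃ ∧ |(a₄ : ℝ)| ≤ A₄ ∧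
        IsCoprime s (d ^ 2) ∧ |(s : ℝ)| ≤ S ∧ |(e : ℝ)| ≤ E ∧
        e ^ 2 = s ^ 5 + a₂ * s ^ 3 * d ^ 4 + a₃ * s ^ 2 * d ^ 6 + a₄ * s * d ^ 8 + a₅ * d ^ 10) :
    (P.card : ℝ) ≤ ((2 * S / (d : ℝ) ^ 2 + 1) *
      ((4 * (4 * E / (d : ℝ) ^ 4) + (d : ℝ) ^ 2) +
        (2 * (2 * A₂) + 1) * (8 * (4 * E / (d : ℝ) ^ 4) + 4 * (2 * A₂)))) *
      ((2 * A₃ / (d : ℝ) ^ 2 + 1) * (2 * A₄ / (d : ℝ) ^ 2 + 1)) := by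
  have hn : 0 < d ^ 2 := by positivity
  refine card_le_mul_of_card_fiber_le P
    (fun p => (p.2.2.2.2.1, p.2.2.2.2.2, p.1)) (by positivity) ?_ ?_
  · refine card_square_congruence _ hd hS hE hA₂ ?_
    intro q hq
    obtain ⟨⟨a₂, a₃, a₄, a₅, s, e⟩, hp, rfl⟩ := Finset.mem_image.1 hq
    obtain ⟨h2, -, -, hc, hs, he, heq⟩ := hP _ hp
    refine ⟨hc, hs, he, h2, a₃ * s ^ 2 + a₄ * s * d ^ 2 + a₅ * d ^ 4, ?_⟩
    simp only
    linear_combination heq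
  rintro ⟨s, e, a₂⟩ -
  set X := P.filter (fun p => (p.2.2.2.2.1, p.2.2.2.2.2, p.1) = (s, e, a₂)) with hX
  have hXmem : ∀ p ∈ X, p ∈ P ∧ p.2.2.2.2.1 = s ∧ p.2.2.2.2.2 = e ∧ p.1 = a₂ := by
    intro p hp
    obtain ⟨h1, h2⟩ := Finset.mem_filter.1 hp
    simpa using And.intro h1 h2
  refine card_le_mul_of_card_fiber_le X (fun p => p.2.1) (by positivity) ?_ ?_
  · have h := card_le_of_dvd_sub (X.image (fun p => p.2.1)) id (fun _ _ _ _ h => h) hn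
      (L := 2 * A₃) (by positivity) ?_ ?_
    · push_cast at h
      exact h
    · intro b hb b' hb'
      obtain ⟨⟨x₂, x₃, x₄, x₅, x, y⟩, hp, rfl⟩ := Finset.mem_image.1 hb
      obtain ⟨⟨x₂', x₃', x₄', x₅', x', y'⟩, hp', rfl⟩ := Finset.mem_image.1 hb'
      obtain ⟨hpP, rfl, rfl, rfl⟩ := hXmem _ hp
      obtain ⟨hpP', h1, h2, h3⟩ := hXmem _ hp'
      simp only at h1 h2 h3
      subst h1 h2 h3
      obtain ⟨-, -, -, hc, -, -, heq⟩ := hP _ hpP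
      obtain ⟨-, -, -, -, -, -, heq'⟩ := hP _ hpP'
      have h4 : d ^ 2 ∣ x' ^ 2 * (x₃ - x₃') := by
        refine ⟨(x₄' - x₄) * x' + (x₅' - x₅) * d ^ 2, ?_⟩
        refine mul_left_cancel₀ (pow_ne_zero 6 hd.ne') ?_
        linear_combination heq' - heq
      exact (IsCoprime.pow_left hc).symm.dvd_of_dvd_mul_left h4
    · have key : ∀ b : ℤ, b ∈ X.image (fun p => p.2.1) → |(b : ℝ)| ≤ A₃ := by
        intro b hb
        obtain ⟨p, hp, rfl⟩ := Finset.mem_image.1 hb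
        exact (hP p (hXmem p hp).1).2.1
      intro b hb b' hb'
      have := (abs_le.1 (abs_sub_le_two_mul (key b hb) (key b' hb'))).2
      simpa using this
  · intro a₃ _
    have h := card_le_of_dvd_sub (X.filter (fun p => p.2.1 = a₃)) (fun p => p.2.2.1) ?_ hn
      (L := 2 * A₄) (by positivity) ?_ ?_
    · push_cast at h
      exact h
    · rintro ⟨x₂, x₃, x₄, x₅, x, y⟩ hp ⟨x₂', x₃', x₄', x₅', x', y'⟩ hp' h4
      obtain ⟨hp, h6⟩ := Finset.mem_filter.1 hp
      obtain ⟨hp', h5⟩ := Finset.mem_filter.1 hp'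
      obtain ⟨hpP, rfl, rfl, rfl⟩ := hXmem _ hp
      obtain ⟨hpP', h1, h2, h3⟩ := hXmem _ hp'
      simp only at h1 h2 h3 h4 h5 h6
      subst h1 h2 h3 h4 h5 h6
      have heq := (hP _ hpP).2.2.2.2.2.2
      have heq' := (hP _ hpP').2.2.2.2.2.2
      have : x₅ = x₅' := by
        refine mul_right_cancel₀ (pow_ne_zero 10 hd.ne') ?_
        linear_combination heq' - heq
      rw [this]
    · rintro ⟨x₂, x₃, x₄, x₅, x, y⟩ hp ⟨x₂', x₃', x₄', x₅', x', y'⟩ hp'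
      obtain ⟨hp, h6⟩ := Finset.mem_filter.1 hp
      obtain ⟨hp', h5⟩ := Finset.mem_filter.1 hp'
      obtain ⟨hpP, rfl, rfl, rfl⟩ := hXmem _ hp
      obtain ⟨hpP', h1, h2, h3⟩ := hXmem _ hp'
      simp only at h1 h2 h3 h5 h6
      subst h1 h2 h3 h5 h6
      obtain ⟨-, -, -, hc, -, -, heq⟩ := hP _ hpP
      have heq' := (hP _ hpP').2.2.2.2.2.2
      have h4 : d ^ 2 ∣ x' * (x₄ - x₄') := by
        refine ⟨x₅' - x₅, ?_⟩
        refine mul_left_cancel₀ (pow_ne_zero 8 hd.ne') ?_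
        linear_combination heq' - heq
      exact hc.symm.dvd_of_dvd_mul_left h4
    · intro p hp p' hp'
      have h1 := (hP p (hXmem p (Finset.mem_filter.1 hp).1).1).2.2.1
      have h2 := (hP p' (hXmem p' (Finset.mem_filter.1 hp').1).1).2.2.1
      have := (abs_le.1 (abs_sub_le_two_mul h1 h2)).2
      simpa using this

/-- The bound of `card_points_of_denominator` for `f` of height at most `t²`. -/
theorem denominator_bound_le {M t d : ℝ} (hM : 1 ≤ M) (ht : 1 ≤ t) (hd : 1 ≤ d)
    (hdt : d ≤ t ^ 8) :
    ((2 * (M * t ^ 2 * d ^ 2) / d ^ 2 + 1) *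
      ((4 * (4 * (3 * M ^ 3 * t ^ 5 * d ^ 5) / d ^ 4) + d ^ 2) +
        (2 * (2 * t ^ 4) + 1) * (8 * (4 * (3 * M ^ 3 * t ^ 5 * d ^ 5) / d ^ 4)
          + 4 * (2 * t ^ 4)))) *
      ((2 * t ^ 6 / d ^ 2 + 1) * (2 * t ^ 8 / d ^ 2 + 1)) ≤
    6816 * M ^ 4 * (2 * t ^ 25 * (d ^ 2)⁻¹ + 6 * t ^ 19) := by
  have hd0 : 0 < d := by linarith
  have ht0 : 0 < t := by linarith
  have hM0 : 0 < M := by linarith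
  have e1 : 2 * (M * t ^ 2 * d ^ 2) / d ^ 2 = 2 * M * t ^ 2 := by field_simp
  have e2 : 4 * (3 * M ^ 3 * t ^ 5 * d ^ 5) / d ^ 4 = 12 * M ^ 3 * t ^ 5 * d := by
    field_simp
    ring
  rw [e1, e2]
  have b1 : 2 * M * t ^ 2 + 1 ≤ 3 * M * t ^ 2 := by
    have : 1 ≤ M * t ^ 2 := one_le_mul_of_one_le_of_one_le hM (one_le_pow₀ ht)
    linarith
  have hM3 : 1 ≤ M ^ 3 := one_le_pow₀ hM
  have p1 : t ^ 4 ≤ M ^ 3 * t ^ 5 * d := by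
    have h1 : t ^ 4 ≤ t ^ 5 := pow_le_pow_right₀ ht (by norm_num)
    have h2 : 1 * t ^ 5 * 1 ≤ M ^ 3 * t ^ 5 * d := by gcongr
    linarith
  have p2 : M ^ 3 * t ^ 5 * d ≤ M ^ 3 * t ^ 9 * d := by
    gcongr
    norm_num
  have b2 : (4 * (12 * M ^ 3 * t ^ 5 * d) + d ^ 2) +
      (2 * (2 * t ^ 4) + 1) * (8 * (12 * M ^ 3 * t ^ 5 * d) + 4 * (2 * t ^ 4)) ≤
      568 * M ^ 3 * (d ^ 2 + t ^ 9 * d) := by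
    have h1 : (2 * (2 * t ^ 4) + 1) ≤ 5 * t ^ 4 := by
      have : 1 ≤ t ^ 4 := one_le_pow₀ ht
      linarith
    have h2 : (2 * (2 * t ^ 4) + 1) * (8 * (12 * M ^ 3 * t ^ 5 * d) + 4 * (2 * t ^ 4)) ≤
        5 * t ^ 4 * (8 * (12 * M ^ 3 * t ^ 5 * d) + 8 * (M ^ 3 * t ^ 5 * d)) := by
      refine mul_le_mul h1 ?_ (by positivity) (by positivity)
      linarith
    have h3 : d ^ 2 ≤ M ^ 3 * d ^ 2 := le_mul_of_one_le_left (by positivity) hM3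
    have h4 : 0 ≤ M ^ 3 * d ^ 2 := by positivity
    have h5 : 5 * t ^ 4 * (8 * (12 * M ^ 3 * t ^ 5 * d) + 8 * (M ^ 3 * t ^ 5 * d))
        = 520 * (M ^ 3 * t ^ 9 * d) := by ring
    linarith
  have b3 : 2 * t ^ 6 / d ^ 2 + 1 ≤ 2 * (t ^ 6 / d ^ 2 + 1) := by
    rw [mul_div_assoc]; linarith
  have b4 : 2 * t ^ 8 / d ^ 2 + 1 ≤ 2 * (t ^ 8 / d ^ 2 + 1) := by
    rw [mul_div_assoc]; linarith
  have b5 : t ^ 2 * (d ^ 2 + t ^ 9 * d) * ((t ^ 6 / d ^ 2 + 1) * (t ^ 8 / d ^ 2 + 1)) ≤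
      2 * t ^ 25 * (d ^ 2)⁻¹ + 6 * t ^ 19 := by
    have e : t ^ 2 * (d ^ 2 + t ^ 9 * d) * ((t ^ 6 / d ^ 2 + 1) * (t ^ 8 / d ^ 2 + 1)) =
        t ^ 16 * (d ^ 2)⁻¹ + t ^ 8 + t ^ 10 + t ^ 2 * d ^ 2 + t ^ 25 * (d ^ 2)⁻¹ * d⁻¹
          + t ^ 17 * d⁻¹ + t ^ 19 * d⁻¹ + t ^ 11 * d := by
      field_simp
      ring
    have hi : d⁻¹ ≤ 1 := inv_le_one_of_one_le₀ hd
    have tp : ∀ n, n ≤ 19 → t ^ n ≤ t ^ 19 := fun n hn => pow_le_pow_right₀ ht hn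
    have c1 : t ^ 16 * (d ^ 2)⁻¹ ≤ t ^ 25 * (d ^ 2)⁻¹ := by
      gcongr
      norm_num
    have c2 : t ^ 2 * d ^ 2 ≤ t ^ 2 * (t ^ 8) ^ 2 := by gcongr
    have c2' : t ^ 2 * (t ^ 8) ^ 2 ≤ t ^ 19 := by
      rw [← pow_mul, ← pow_add]; exact tp _ (by norm_num)
    have c3 : t ^ 25 * (d ^ 2)⁻¹ * d⁻¹ ≤ t ^ 25 * (d ^ 2)⁻¹ :=
      mul_le_of_le_one_right (by positivity) hi
    have c5 : t ^ 17 * d⁻¹ ≤ t ^ 17 := mul_le_of_le_one_right (by positivity) hi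
    have c6 : t ^ 19 * d⁻¹ ≤ t ^ 19 := mul_le_of_le_one_right (by positivity) hi
    have c7 : t ^ 11 * d ≤ t ^ 11 * t ^ 8 := by gcongr
    rw [← pow_add] at c7
    norm_num at c7
    rw [e]
    linarith [tp 8 (by norm_num), tp 10 (by norm_num), tp 17 (by norm_num)]
  calc _ ≤ (3 * M * t ^ 2 * (568 * M ^ 3 * (d ^ 2 + t ^ 9 * d))) *
        ((2 * (t ^ 6 / d ^ 2 + 1)) * (2 * (t ^ 8 / d ^ 2 + 1))) := by gcongr
    _ = 6816 * M ^ 4 *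
        (t ^ 2 * (d ^ 2 + t ^ 9 * d) * ((t ^ 6 / d ^ 2 + 1) * (t ^ 8 / d ^ 2 + 1))) := by ring
    _ ≤ _ := by gcongr

/-- The denominators of a rational point on `y² = f(x)` are `d²` and `d⁵`. -/
theorem exists_den_eq_sq {a₂ a₃ a₄ a₅ : ℤ} {x y : ℚ}
    (h : y ^ 2 = x ^ 5 + (a₂ : ℚ) * x ^ 3 + (a₃ : ℚ) * x ^ 2 + (a₄ : ℚ) * x + (a₅ : ℚ)) :
    ∃ d : ℕ, 0 < d ∧ x.den = d ^ 2 ∧ y.den = d ^ 5 := by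
  set p := x.num with hp
  set q := x.den with hq
  have hq0 : (q : ℚ) ≠ 0 := by exact_mod_cast x.den_ne_zero
  have hx : x = p / q := (Rat.num_div_den x).symm
  have hpq : IsCoprime p (q : ℤ) := by
    rw [Int.isCoprime_iff_gcd_eq_one]
    exact x.reduced
  obtain ⟨N, hN⟩ : ∃ N : ℤ, N = p ^ 5 + q * (a₂ * p ^ 3 * q + a₃ * p ^ 2 * q ^ 2 + a₄ * p * q ^ 3
      + a₅ * q ^ 4) := ⟨_, rfl⟩
  have hNq : IsCoprime N ((q : ℤ) ^ 5) := by
    rw [hN]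
    exact IsCoprime.pow_right ((IsCoprime.pow_left hpq).add_mul_left_left _)
  have hy : y ^ 2 = (N : ℚ) / ((q ^ 5 : ℕ) : ℤ) := by
    rw [h, hx, hN]
    push_cast
    field_simp
    ring
  have hden : (y ^ 2).den = q ^ 5 := by
    have h1 := Rat.den_div_eq_of_coprime (a := N) (b := ((q ^ 5 : ℕ) : ℤ))
      (by exact_mod_cast pow_pos x.den_pos 5) (by
        rw [← Int.isCoprime_iff_nat_coprime]
        push_cast
        exact hNq)
    rw [← hy] at h1
    exact_mod_cast h1
  rw [Rat.den_pow] at hden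
  have hdvd : q ^ 2 ∣ y.den := by
    rw [← Nat.pow_dvd_pow_iff (n := 2) (by norm_num), hden]
    exact ⟨q, by ring⟩
  obtain ⟨d, hd⟩ := hdvd
  have hqpos : 0 < q := x.den_pos
  have hdq : q = d ^ 2 := by
    rw [hd] at hden
    refine Nat.eq_of_mul_eq_mul_left (pow_pos hqpos 4) ?_
    linarith [hden, (by ring : q ^ 4 * q = q ^ 5), (by ring : (q ^ 2 * d) ^ 2 = q ^ 4 * d ^ 2)]
  refine ⟨d, ?_, hdq, ?_⟩
  · rcases Nat.eq_zero_or_pos d with rfl | h0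
    · simp at hdq; omega
    · exact h0
  · rw [hd, hdq]; ring

theorem Hf_nonneg (a₂ a₃ a₄ a₅ : ℤ) : 0 ≤ Hf a₂ a₃ a₄ a₅ :=
  le_max_of_le_left (le_max_of_le_left (by positivity))

theorem Hf_le {a₂ a₃ a₄ a₅ : ℤ} {T : ℝ} (hT : 0 ≤ T) (h2 : |(a₂ : ℝ)| ≤ T ^ 2)
    (h3 : |(a₃ : ℝ)| ≤ T ^ 3) (h4 : |(a₄ : ℝ)| ≤ T ^ 4) (h5 : |(a₅ : ℝ)| ≤ T ^ 5) :
    Hf a₂ a₃ a₄ a₅ ≤ T := by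
  have key : ∀ (a : ℝ) (n : ℕ), n ≠ 0 → 0 ≤ a → a ≤ T ^ n → a ^ ((1 : ℝ) / n) ≤ T := by
    intro a n hn ha h
    calc a ^ ((1 : ℝ) / n) ≤ (T ^ n) ^ ((1 : ℝ) / n) := by gcongr
      _ = T := by rw [one_div]; exact Real.pow_rpow_inv_natCast hT hn
  refine max_le (max_le ?_ ?_) (max_le ?_ ?_)
  · exact_mod_cast key _ 2 (by norm_num) (abs_nonneg _) h2
  · exact_mod_cast key _ 3 (by norm_num) (abs_nonneg _) h3
  · exact_mod_cast key _ 4 (by norm_num) (abs_nonneg _) h4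
  · exact_mod_cast key _ 5 (by norm_num) (abs_nonneg _) h5

theorem abs_le_of_sq_eq_quintic {M t a₂ a₃ a₄ a₅ x y : ℝ} (hM : 1 ≤ M) (ht : 0 ≤ t)
    (h2 : |a₂| ≤ (t ^ 2) ^ 2) (h3 : |a₃| ≤ (t ^ 2) ^ 3) (h4 : |a₄| ≤ (t ^ 2) ^ 4)
    (h5 : |a₅| ≤ (t ^ 2) ^ 5) (hx : |x| ≤ M * t ^ 2)
    (h : y ^ 2 = x ^ 5 + a₂ * x ^ 3 + a₃ * x ^ 2 + a₄ * x + a₅) : |y| ≤ 3 * M ^ 3 * t ^ 5 := by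
  have hM0 : 0 ≤ M := by linarith
  refine abs_le_of_sq_le_sq ?_ (by positivity)
  have hb : y ^ 2 ≤ |x| ^ 5 + |a₂| * |x| ^ 3 + |a₃| * |x| ^ 2 + |a₄| * |x| + |a₅| := by
    rw [h, ← abs_pow, ← abs_pow, ← abs_pow, ← abs_mul, ← abs_mul, ← abs_mul]
    gcongr <;> exact le_abs_self _
  have hb2 : |x| ^ 5 + |a₂| * |x| ^ 3 + |a₃| * |x| ^ 2 + |a₄| * |x| + |a₅| ≤
      (M * t ^ 2) ^ 5 + (t ^ 2) ^ 2 * (M * t ^ 2) ^ 3 + (t ^ 2) ^ 3 * (M * t ^ 2) ^ 2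
        + (t ^ 2) ^ 4 * (M * t ^ 2) + (t ^ 2) ^ 5 := by gcongr
  have hb3 : (M * t ^ 2) ^ 5 + (t ^ 2) ^ 2 * (M * t ^ 2) ^ 3 + (t ^ 2) ^ 3 * (M * t ^ 2) ^ 2
        + (t ^ 2) ^ 4 * (M * t ^ 2) + (t ^ 2) ^ 5
      = (M ^ 5 + M ^ 3 + M ^ 2 + M ^ 1 + M ^ 0) * t ^ 10 := by ring
  have hp : ∀ n, n ≤ 6 → M ^ n ≤ M ^ 6 := fun n hn => pow_le_pow_right₀ hM hn
  have hb4 : (M ^ 5 + M ^ 3 + M ^ 2 + M ^ 1 + M ^ 0) * t ^ 10 ≤ 9 * M ^ 6 * t ^ 10 := by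
    refine mul_le_mul_of_nonneg_right ?_ (by positivity)
    linarith [hp 5 (by norm_num), hp 3 (by norm_num), hp 2 (by norm_num), hp 1 (by norm_num),
      hp 0 (by norm_num), hp 6 le_rfl, (by positivity : 0 ≤ M ^ 6)]
  have hb5 : (3 * M ^ 3 * t ^ 5) ^ 2 = 9 * M ^ 6 * t ^ 10 := by ring
  linarith

theorem card_subset_smallDownSet {δ t M : ℝ} (hδ : 0 < δ) (hδ1 : δ < 1) (ht : 1 ≤ t) (hM : 1 ≤ M)
    (hMδ : δ ^ (-(1 / δ)) ≤ M) (F : Finset (ℤ × ℤ × ℤ × ℤ × ℚ × ℚ))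
    (hF : ∀ p ∈ F, p ∈ SmallDownSet δ (t ^ 2)) :
    (F.card : ℝ) ≤ 68160 * M ^ 4 * t ^ 27 := by
  have ht0 : 0 < t := by linarith
  have hM0 : 0 < M := by linarith
  have hden : ∀ p ∈ F, ∃ d : ℕ, 0 < d ∧ (d : ℝ) ≤ t ^ 8 ∧ p.2.2.2.2.1.den = d ^ 2 ∧
      p.2.2.2.2.2.den = d ^ 5 ∧ |(p.2.2.2.2.1 : ℝ)| ≤ M * t ^ 2 := by
    rintro ⟨a₂, a₃, a₄, a₅, x, y⟩ hp
    obtain ⟨h2, h3, h4, h5, -, heq, hx, hH⟩ := hF _ hp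
    simp only at h2 h3 h4 h5 heq hx hH ⊢
    obtain ⟨d, hd0, hd2, hd5⟩ := exists_den_eq_sq heq
    have hHf := Hf_le (by positivity) h2 h3 h4 h5
    have hHf0 := Hf_nonneg a₂ a₃ a₄ a₅
    refine ⟨d, hd0, ?_, hd2, hd5, hx.le.trans (mul_le_mul hMδ hHf hHf0 hM0.le)⟩
    have h6 : (x.den : ℝ) ≤ Hq x := le_max_right _ _
    have h7 : Hf a₂ a₃ a₄ a₅ ^ ((8 : ℝ) - δ) ≤ (t ^ 2) ^ (8 : ℝ) :=
      calc Hf a₂ a₃ a₄ a₅ ^ ((8 : ℝ) - δ) ≤ (t ^ 2) ^ ((8 : ℝ) - δ) :=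
            Real.rpow_le_rpow hHf0 hHf (by linarith)
        _ ≤ (t ^ 2) ^ (8 : ℝ) :=
            Real.rpow_le_rpow_of_exponent_le (one_le_pow₀ ht) (by linarith)
    have h8 : (t ^ 2) ^ (8 : ℝ) = (t ^ 8) ^ 2 := by
      rw [show (8 : ℝ) = ((8 : ℕ) : ℝ) by norm_num, Real.rpow_natCast]
      ring
    have h9 : (d : ℝ) ^ 2 ≤ (t ^ 8) ^ 2 := by
      rw [hd2] at h6
      push_cast at h6
      exact h6.trans (hH.le.trans (h7.trans h8.le))
    exact le_of_sq_le_sq h9 (by positivity)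
  set D := ⌊t ^ 8⌋₊ with hD
  have h := card_le_sum_of_card_fiber_le F (Finset.Ioo 0 (D + 1))
    (fun p => Nat.sqrt p.2.2.2.2.1.den) ?_
    (fun d => 6816 * M ^ 4 * (2 * t ^ 25 * ((d : ℝ) ^ 2)⁻¹ + 6 * t ^ 19)) ?_
  · refine h.trans ?_
    rw [← Finset.mul_sum, Finset.sum_add_distrib, ← Finset.mul_sum, Finset.sum_const,
      nsmul_eq_mul, Nat.card_Ioo]
    have h1 : ∑ i ∈ Finset.Ioo 0 (D + 1), ((i : ℝ) ^ 2)⁻¹ ≤ 2 := by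
      simpa using sum_Ioo_inv_sq_le (α := ℝ) 0 (D + 1)
    have h2 : ((D + 1 - 0 - 1 : ℕ) : ℝ) ≤ t ^ 8 := by
      simpa using Nat.floor_le (by positivity : 0 ≤ t ^ 8)
    have h3 : t ^ 25 ≤ t ^ 27 := pow_le_pow_right₀ ht (by norm_num)
    calc _ ≤ 6816 * M ^ 4 * (2 * t ^ 25 * 2 + t ^ 8 * (6 * t ^ 19)) := by gcongr
      _ ≤ 6816 * M ^ 4 * (2 * t ^ 27 * 2 + t ^ 8 * (6 * t ^ 19)) := by gcongr
      _ = _ := by ring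
  · intro p hp
    obtain ⟨d, hd0, hdt, hd2, -⟩ := hden p hp
    rw [hd2, Nat.sqrt_eq', Finset.mem_Ioo]
    exact ⟨hd0, Nat.lt_succ_of_le (Nat.le_floor hdt)⟩
  intro d hd
  have hd0 : 0 < d := (Finset.mem_Ioo.1 hd).1
  have hdt : (d : ℝ) ≤ t ^ 8 :=
    (Nat.le_floor_iff (by positivity)).1 (Nat.lt_succ_iff.1 (Finset.mem_Ioo.1 hd).2)
  have hdR : (0 : ℝ) < d := by exact_mod_cast hd0
  set X := F.filter (fun p => Nat.sqrt p.2.2.2.2.1.den = d) with hX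
  have hXmem : ∀ p ∈ X, p ∈ F ∧ p.2.2.2.2.1.den = d ^ 2 ∧
      p.2.2.2.2.2.den = d ^ 5 ∧ |(p.2.2.2.2.1 : ℝ)| ≤ M * t ^ 2 := by
    intro p hp
    obtain ⟨h1, h2⟩ := Finset.mem_filter.1 hp
    obtain ⟨d', -, -, h3, h4, h5⟩ := hden p h1
    rw [h3, Nat.sqrt_eq'] at h2
    subst h2
    exact ⟨h1, h3, h4, h5⟩
  set g : ℤ × ℤ × ℤ × ℤ × ℚ × ℚ → ℤ × ℤ × ℤ × ℤ × ℤ × ℤ :=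
    fun p => (p.1, p.2.1, p.2.2.1, p.2.2.2.1, p.2.2.2.2.1.num, p.2.2.2.2.2.num) with hg
  have hcard : X.card = (X.image g).card := by
    refine (Finset.card_image_of_injOn ?_).symm
    rintro ⟨a₂, a₃, a₄, a₅, x, y⟩ hp ⟨a₂', a₃', a₄', a₅', x', y'⟩ hp' heq
    obtain ⟨-, h1, h2, -⟩ := hXmem _ hp
    obtain ⟨-, h1', h2', -⟩ := hXmem _ hp'
    simp only [hg, Prod.mk.injEq] at heq ⊢
    obtain ⟨e1, e2, e3, e4, e5, e6⟩ := heq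
    exact ⟨e1, e2, e3, e4, Rat.ext e5 (h1.trans h1'.symm), Rat.ext e6 (h2.trans h2'.symm)⟩
  rw [hcard]
  have hbound := card_points_of_denominator (X.image g) (d := d) (by exact_mod_cast hd0)
    (S := M * t ^ 2 * (d : ℝ) ^ 2) (E := 3 * M ^ 3 * t ^ 5 * (d : ℝ) ^ 5)
    (A₂ := t ^ 4) (A₃ := t ^ 6) (A₄ := t ^ 8) (by positivity) (by positivity) (by positivity)
    (by positivity) (by positivity) ?_
  · push_cast at hbound
    exact hbound.trans (denominator_bound_le hM ht (by exact_mod_cast hd0) hdt)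
  intro r hr
  obtain ⟨⟨a₂, a₃, a₄, a₅, x, y⟩, hp, rfl⟩ := Finset.mem_image.1 hr
  obtain ⟨hpF, hxd, hyd, hx⟩ := hXmem _ hp
  obtain ⟨h2, h3, h4, h5, -, heq, -, -⟩ := hF _ hpF
  simp only [hg] at h2 h3 h4 h5 heq hxd hyd hx ⊢
  have hxe : x = x.num / (d : ℚ) ^ 2 := by
    conv_lhs => rw [← Rat.num_div_den x, hxd]
    push_cast
    rfl
  have hye : y = y.num / (d : ℚ) ^ 5 := by
    conv_lhs => rw [← Rat.num_div_den y, hyd]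
    push_cast
    rfl
  have hdQ : (d : ℚ) ≠ 0 := by exact_mod_cast hd0.ne'
  have hxR : (x.num : ℝ) = x * (d : ℝ) ^ 2 := by
    have : (x.num : ℚ) = x * (d : ℚ) ^ 2 := by
      rw [eq_comm, ← eq_div_iff (pow_ne_zero _ hdQ)]; exact hxe
    exact_mod_cast this
  have hyR : (y.num : ℝ) = y * (d : ℝ) ^ 5 := by
    have : (y.num : ℚ) = y * (d : ℚ) ^ 5 := by
      rw [eq_comm, ← eq_div_iff (pow_ne_zero _ hdQ)]; exact hye
    exact_mod_cast this
  refine ⟨by rwa [← pow_mul] at h2, by rwa [← pow_mul] at h3, by rwa [← pow_mul] at h4,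
    ?_, ?_, ?_, ?_⟩
  · have : IsCoprime x.num (x.den : ℤ) := by
      rw [Int.isCoprime_iff_gcd_eq_one]
      exact x.reduced
    rw [hxd] at this
    exact_mod_cast this
  · rw [hxR, abs_mul, abs_of_pos (by positivity : (0 : ℝ) < (d : ℝ) ^ 2)]
    gcongr
  · have hyb := abs_le_of_sq_eq_quintic (x := (x : ℝ)) (y := (y : ℝ)) hM ht0.le h2 h3 h4 h5 hx
      (by exact_mod_cast heq)
    rw [hyR, abs_mul, abs_of_pos (by positivity : (0 : ℝ) < (d : ℝ) ^ 5)]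
    gcongr
  · have : (y.num : ℚ) ^ 2 = (x.num : ℚ) ^ 5 + a₂ * (x.num : ℚ) ^ 3 * (d : ℚ) ^ 4
        + a₃ * (x.num : ℚ) ^ 2 * (d : ℚ) ^ 6 + a₄ * (x.num : ℚ) * (d : ℚ) ^ 8
        + a₅ * (d : ℚ) ^ 10 := by
      rw [hxe, hye] at heq
      field_simp at heq
      linear_combination heq
    exact_mod_cast this

theorem finite_and_ncard_le_of_forall_finset {α : Type*} {s : Set α} {B : ℝ}
    (h : ∀ F : Finset α, (∀ p ∈ F, p ∈ s) → (F.card : ℝ) ≤ B) :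
    s.Finite ∧ (s.ncard : ℝ) ≤ B := by
  have hfin : s.Finite := by
    by_contra hinf
    obtain ⟨F, hF, hcard⟩ := Set.Infinite.exists_subset_card_eq hinf (⌊B⌋₊ + 1)
    have h1 := h F (fun p hp => hF hp)
    rw [hcard] at h1
    push_cast at h1
    linarith [Nat.lt_floor_add_one B]
  refine ⟨hfin, ?_⟩
  rw [Set.ncard_eq_toFinset_card s hfin]
  exact h _ (fun p hp => hfin.mem_toFinset.1 hp)

/-- The total number of small points with small `x`-coordinate in the family of height at
most `T` is `O(T^(14 - c))`. -/
theorem count_small_points_with_small_x :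
    ∃ δ₀ : ℝ, 0 < δ₀ ∧ ∀ δ : ℝ, 0 < δ → δ < δ₀ →
      ∃ c C : ℝ, 0 < c ∧ 0 < C ∧ ∀ T : ℝ, 2 ≤ T →
        (SmallDownSet δ T).Finite ∧
        ((SmallDownSet δ T).ncard : ℝ) ≤ C * T ^ ((14 : ℝ) - c) := by
  refine ⟨1, one_pos, fun δ hδ hδ1 => ?_⟩
  obtain ⟨M, hM⟩ : ∃ M : ℝ, M = max 1 (δ ^ (-(1 / δ))) := ⟨_, rfl⟩
  have hM1 : 1 ≤ M := hM ▸ le_max_left _ _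
  refine ⟨1 / 2, 68160 * M ^ 4, by norm_num, by positivity, fun T hT => ?_⟩
  refine finite_and_ncard_le_of_forall_finset fun F hF => ?_
  have hT0 : 0 ≤ T := by linarith
  have hsq : √T ^ 2 = T := Real.sq_sqrt hT0
  have hpow : T ^ ((14 : ℝ) - 1 / 2) = √T ^ 27 := by
    rw [Real.sqrt_eq_rpow, ← Real.rpow_natCast, ← Real.rpow_mul hT0]
    norm_num
  rw [hpow]
  refine card_subset_smallDownSet hδ hδ1 ?_ hM1 (hM ▸ le_max_right _ _) F ?_
  · rw [Real.one_le_sqrt]; linarith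
  · rwa [hsq]
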